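/- With the same notation, if r > rank(h_{n-d-i+1}) + rank(h_{n-d-i}) then depth_S(I/J) ≤ d+i. -/

import Mathlib

open MvPolynomial

/-- A squarefree exponent vector. -/
def IsSqfree {n : ℕ} (m : Fin n →₀ ℕ) : Prop := ∀ j, m j ≤ 1

/-- Total degree of an exponent vector. -/
def mdeg {n : ℕ} (m : Fin n →₀ ℕ) : ℕ := m.sum fun _ e => e

/-- `I` is generated by squarefree monomials of degree `≥ d`. -/
def GenSqfreeGe (K : Type*) [Field K] {n : ℕ} (d : ℕ)
    (I : Ideal (MvPolynomial (Fin n) K)) : Prop :=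
  ∃ G : Set (Fin n →₀ ℕ), (∀ m ∈ G, IsSqfree m ∧ d ≤ mdeg m) ∧
    I = Ideal.span ((fun m => monomial m (1 : K)) '' G)

/-- `ρ_t(I \ J)`: the number of squarefree monomials of degree `t` in `I \ J`. -/
noncomputable def rho (K : Type*) [Field K] {n : ℕ}
    (I J : Ideal (MvPolynomial (Fin n) K)) (t : ℕ) : ℕ :=
  Set.ncard {m : Fin n →₀ ℕ | IsSqfree m ∧ mdeg m = t ∧
    monomial m (1 : K) ∈ I ∧ monomial m (1 : K) ∉ J}

/-- The `S`-module `I/J`. -/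
abbrev quotMod {K : Type*} [Field K] {n : ℕ}
    (I J : Ideal (MvPolynomial (Fin n) K)) :=
  I ⧸ (Submodule.comap I.subtype (J : Submodule (MvPolynomial (Fin n) K) (MvPolynomial (Fin n) K)))

/-- Depth of a module over `K[x_1,…,x_n]` w.r.t. the maximal graded ideal
`(x_1,…,x_n)`: the supremum of lengths of regular sequences on `M` from it. -/
noncomputable def mdepth (K : Type*) [Field K] (n : ℕ)
    (M : Type*) [AddCommGroup M] [Module (MvPolynomial (Fin n) K) M] : ℕ :=
  sSup {k | ∃ rs : List (MvPolynomial (Fin n) K), rs.length = k ∧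
    (∀ r ∈ rs, r ∈ Ideal.span (Set.range (X : Fin n → MvPolynomial (Fin n) K))) ∧
    RingTheory.Sequence.IsRegular M rs}

open Classical in
/-- The Koszul sign: if `b = f · x_j` this is the sign with which `x_j e_{σ_f}`
appears in `∂(e_{τ_b})`, where `e_σ` for a squarefree monomial is the wedge of the
`e_l` over `l` outside its support; otherwise `0`. -/
noncomputable def kSign (K : Type*) [Field K] {n : ℕ} (f b : Fin n →₀ ℕ) : K :=
  if h : ∃ j, b = f + Finsupp.single j 1 then
    (-1 : K) ^ (Finset.univ.filter (fun l : Fin n => f l = 0 ∧ l < h.choose)).card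
  else 0

section Koszul

variable {ι R M N : Type*} [LinearOrder ι] [CommRing R]
  [AddCommGroup M] [Module R M] [AddCommGroup N] [Module R N]

/-- The sign of moving `e_j` past the `e_l` with `l ∈ σ`, `l < j`. -/
def koszulSign (R : Type*) [CommRing R] (j : ι) (σ : Finset ι) : R :=
  (-1) ^ (σ.filter (· < j)).card

theorem koszulSign_mul_self (j : ι) (σ : Finset ι) :
    koszulSign R j σ * koszulSign R j σ = 1 := by
  rw [koszulSign, ← mul_pow]; simp

theorem koszulSign_insert {j k : ι} {σ : Finset ι} (hk : k ∉ σ) :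
    koszulSign R j (insert k σ) = (if k < j then -1 else 1) * koszulSign R j σ := by
  unfold koszulSign
  rw [Finset.filter_insert]
  split_ifs with h
  · rw [Finset.card_insert_of_notMem (by simp [hk]), pow_succ']
  · simp

variable [Fintype ι]

/-- The Koszul differential with coefficients in `M`; a chain assigns to each finite set `σ`
the coefficient of the wedge product `e_σ`. -/
def koszulD (x : ι → R) : (Finset ι → M) →ₗ[R] (Finset ι → M) where
  toFun z σ := ∑ j, if j ∈ σ then 0 else (koszulSign R j σ * x j) • z (insert j σ)
  map_add' z w := by
    ext σ
    simp only [Pi.add_apply, ← Finset.sum_add_distrib]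
    refine Finset.sum_congr rfl fun j _ => ?_
    split_ifs <;> simp
  map_smul' a z := by
    ext σ
    simp only [Pi.smul_apply, RingHom.id_apply, Finset.smul_sum]
    refine Finset.sum_congr rfl fun j _ => ?_
    split_ifs
    · simp
    · rw [smul_comm]

theorem koszulD_apply (x : ι → R) (z : Finset ι → M) (σ : Finset ι) :
    koszulD x z σ =
      ∑ j, if j ∈ σ then 0 else (koszulSign R j σ * x j) • z (insert j σ) := rfl

theorem koszulD_comp (x : ι → R) (φ : M →ₗ[R] N) (z : Finset ι → M) :
    koszulD x (fun σ => φ (z σ)) = fun σ => φ (koszulD x z σ) := by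
  ext σ
  simp only [koszulD_apply, map_sum]
  refine Finset.sum_congr rfl fun j _ => ?_
  split_ifs <;> simp

theorem sum_sum_eq_zero_of_antisymm (F : ι → ι → M) (h : ∀ j k, j ≠ k → F j k + F k j = 0)
    (h0 : ∀ j, F j j = 0) : ∑ j, ∑ k, F j k = 0 := by
  rw [← Fintype.sum_prod_type' (f := F)]
  refine Finset.sum_involution (fun p _ => p.swap) ?_ ?_ (by simp) (by simp)
  · rintro ⟨j, k⟩ _
    by_cases hjk : j = k
    · subst hjk; simp [h0]
    · exact h j k hjk
  · rintro ⟨j, k⟩ _ hne heq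
    simp only [Prod.swap_prod_mk, Prod.mk.injEq] at heq
    obtain ⟨rfl, -⟩ := heq
    exact hne (h0 _)

theorem koszulD_koszulD (x : ι → R) (z : Finset ι → M) : koszulD x (koszulD x z) = 0 := by
  ext σ
  have : koszulD x (koszulD x z) σ = ∑ j, ∑ k, if j ∈ σ ∨ k ∈ insert j σ then 0 else
      (koszulSign R j σ * x j * (koszulSign R k (insert j σ) * x k)) •
        z (insert k (insert j σ)) := by
    rw [koszulD_apply]
    refine Finset.sum_congr rfl fun j _ => ?_
    by_cases hj : j ∈ σ
    · simp [hj]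
    · rw [if_neg hj, koszulD_apply, Finset.smul_sum]
      refine Finset.sum_congr rfl fun k _ => ?_
      by_cases hk : k ∈ insert j σ
      · simp [hk]
      · simp [hk, hj, mul_smul]
  rw [this]
  refine sum_sum_eq_zero_of_antisymm _ (fun j k hjk => ?_) (by simp)
  by_cases hj : j ∈ σ
  · simp [hj]
  by_cases hk : k ∈ σ
  · simp [hk]
  rw [if_neg (by simp [hj, hk, hjk.symm]), if_neg (by simp [hj, hk, hjk]),
    koszulSign_insert hj, koszulSign_insert hk, Finset.insert_comm, ← add_smul]
  convert zero_smul R _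
  rcases lt_or_gt_of_ne hjk with h | h
  · rw [if_pos h, if_neg h.not_gt]; ring
  · rw [if_neg h.not_gt, if_pos h]; ring

/-- Left multiplication by `e_i` on the Koszul complex. -/
def koszulWedge (R : Type*) [CommRing R] [Module R M] (i : ι) (z : Finset ι → M) :
    Finset ι → M :=
  fun σ => if i ∈ σ then koszulSign R i σ • z (σ.erase i) else 0

theorem koszulD_wedge (x : ι → R) (i : ι) (z : Finset ι → M) :
    koszulD x (koszulWedge R i z) + koszulWedge R i (koszulD x z) = x i • z := by
  ext σ
  rw [Pi.add_apply, Pi.smul_apply]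
  by_cases hi : i ∈ σ
  · obtain ⟨τ, hiτ, rfl⟩ : ∃ τ, i ∉ τ ∧ insert i τ = σ :=
      ⟨σ.erase i, by simp, Finset.insert_erase hi⟩
    rw [koszulWedge, if_pos hi, Finset.erase_insert hiτ, koszulD_apply, koszulD_apply,
      Finset.smul_sum, ← Finset.sum_add_distrib]
    rw [Finset.sum_eq_single i]
    · rw [koszulSign_insert hiτ]
      simp [hiτ, smul_smul, ← mul_assoc, koszulSign_mul_self]
    · intro j _ hji
      by_cases hj : j ∈ τ
      · simp [hj]
      rw [if_neg (by simp [hj, hji]), if_neg hj, koszulWedge, if_pos (by simp),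
        Finset.insert_comm, Finset.erase_insert (by simp [hiτ, hji.symm]),
        koszulSign_insert (k := i) hiτ, koszulSign_insert (k := i) (by simp [hiτ, hji.symm]),
        koszulSign_insert (k := i) hiτ, koszulSign_insert hj, smul_smul, smul_smul, ← add_smul]
      convert zero_smul R _
      rcases lt_or_gt_of_ne hji with h | h
      · rw [if_pos h, if_neg h.not_gt]; simp; ring
      · rw [if_neg h.not_gt, if_pos h]; simp; ring
    · simp
  · rw [koszulD_apply, Finset.sum_eq_single i]
    · simp [koszulWedge, hi, smul_smul, koszulSign_insert hi,
        mul_right_comm _ (x i), koszulSign_mul_self]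
    · intro j _ hji
      by_cases hj : j ∈ σ
      · simp [hj]
      · simp [hj, koszulWedge, hi, hji.symm]
    · simp

theorem exists_koszulD_eq_smul (x : ι → R) {r : R} (hr : r ∈ Ideal.span (Set.range x))
    {m : ℕ} {z : Finset ι → M} (hz : koszulD x z = 0) (hm : ∀ σ, σ.card < m → z σ = 0) :
    ∃ w : Finset ι → M, koszulD x w = r • z ∧ ∀ σ, σ.card < m + 1 → w σ = 0 := by
  induction hr using Submodule.span_induction with
  | mem r h =>
    obtain ⟨i, rfl⟩ := h
    refine ⟨koszulWedge R i z, ?_, fun σ hσ => ?_⟩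
    · have h := koszulD_wedge x i z
      rw [hz] at h
      rw [← h, left_eq_add]
      ext σ
      simp [koszulWedge]
    · unfold koszulWedge
      split_ifs with hi
      · rw [hm, smul_zero]
        rw [Finset.card_erase_of_mem hi]
        have := Finset.card_pos.2 ⟨i, hi⟩
        omega
      · rfl
  | zero => exact ⟨0, by simp, by simp⟩
  | add a b _ _ ha hb =>
    obtain ⟨w, hw, hw'⟩ := ha
    obtain ⟨v, hv, hv'⟩ := hb
    exact ⟨w + v, by rw [map_add, hw, hv, add_smul],
      fun σ hσ => by simp [hw' σ hσ, hv' σ hσ]⟩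
  | smul a b _ hb =>
    obtain ⟨w, hw, hw'⟩ := hb
    exact ⟨a • w, by rw [map_smul, hw, smul_assoc], fun σ hσ => by simp [hw' σ hσ]⟩

/-- Depth sensitivity of the Koszul complex: a weakly `M`-regular sequence of length `k` in the
ideal generated by `x` kills Koszul homology in degrees above `card ι - k`. -/
theorem exists_koszulD_eq_of_isWeaklyRegular (x : ι → R) (rs : List R)
    (hrs : ∀ r ∈ rs, r ∈ Ideal.span (Set.range x)) (hreg : RingTheory.Sequence.IsWeaklyRegular M rs)
    (z : Finset ι → M) (hz : koszulD x z = 0) {m : ℕ} (hm : ∀ σ, σ.card < m → z σ = 0)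
    (hlen : Fintype.card ι < m + rs.length) : ∃ u, koszulD x u = z := by
  induction rs generalizing M m with
  | nil =>
    refine ⟨0, ?_⟩
    ext σ
    rw [hm σ ((Finset.card_le_univ σ).trans_lt (by simpa using hlen))]
    simp
  | cons r rs ih =>
    rw [RingTheory.Sequence.isWeaklyRegular_cons_iff] at hreg
    obtain ⟨w, hw, hw'⟩ := exists_koszulD_eq_smul x (hrs r (by simp)) hz hm
    let π : M →ₗ[R] QuotSMulTop r M := Submodule.mkQ _
    have hsurj : Function.Surjective π := Submodule.mkQ_surjective _
    have hker : ∀ y : M, π y = 0 → ∃ v, r • v = y := by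
      intro y hy
      rw [Submodule.mkQ_apply, Submodule.Quotient.mk_eq_zero,
        Submodule.mem_smul_pointwise_iff_exists] at hy
      obtain ⟨v, -, hv⟩ := hy
      exact ⟨v, hv⟩
    have hπr : ∀ y : M, π (r • y) = 0 := by
      intro y
      rw [Submodule.mkQ_apply, Submodule.Quotient.mk_eq_zero]
      exact Submodule.smul_mem_pointwise_smul _ _ _ trivial
    obtain ⟨u, hu⟩ := ih (fun a ha => hrs a (by simp [ha])) hreg.2 (fun σ => π (w σ))
      (by rw [koszulD_comp, hw]; ext σ; exact hπr _) (m := m + 1)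
      (fun σ hσ => by rw [hw' σ hσ, map_zero]) (by simp at hlen; omega)
    choose u' hu' using fun σ => hsurj (u σ)
    obtain rfl : (fun σ => π (u' σ)) = u := funext hu'
    rw [koszulD_comp] at hu
    choose v hv using fun σ => hker (w σ - koszulD x u' σ) (by
      rw [map_sub, sub_eq_zero]; exact (congrFun hu σ).symm)
    refine ⟨v, ?_⟩
    have hv' : r • v = w - koszulD x u' := funext hv
    have := congrArg (koszulD x) hv'
    rw [map_smul, map_sub, hw, koszulD_koszulD, sub_zero] at this
    ext σ
    exact hreg.1 (congrFun this σ)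

end Koszul

section Monomials

variable {K : Type*} [Field K] {n : ℕ}

theorem GenSqfreeGe.monomial_mem {d : ℕ} {I : Ideal (MvPolynomial (Fin n) K)}
    (hI : GenSqfreeGe K d I) {p : MvPolynomial (Fin n) K} (hp : p ∈ I) {m : Fin n →₀ ℕ}
    (hm : coeff m p ≠ 0) : monomial m (1 : K) ∈ I := by
  obtain ⟨G, -, rfl⟩ := hI
  rw [mem_ideal_span_monomial_image] at hp ⊢
  intro m' hm'
  obtain rfl : m' = m := by
    by_contra h
    simp [coeff_monomial, Ne.symm h] at hm'
  exact hp m' (by simpa using hm)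

theorem monomial_mem_of_monomial_one_mem {I : Ideal (MvPolynomial (Fin n) K)} {m : Fin n →₀ ℕ}
    (h : monomial m (1 : K) ∈ I) (a : K) : monomial m a ∈ I := by
  simpa [C_mul_monomial] using I.mul_mem_left (C a) h

theorem monomial_add_single_mem {I : Ideal (MvPolynomial (Fin n) K)} {m : Fin n →₀ ℕ}
    (h : monomial m (1 : K) ∈ I) (j : Fin n) :
    monomial (m + Finsupp.single j 1) (1 : K) ∈ I := by
  simpa [X, monomial_mul] using I.mul_mem_right (X j) h

/-- The exponent vector of the product of the variables outside `σ`. -/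
noncomputable def complExp (σ : Finset (Fin n)) : Fin n →₀ ℕ :=
  Finsupp.equivFunOnFinite.symm fun l => if l ∈ σ then 0 else 1

theorem complExp_apply (σ : Finset (Fin n)) (l : Fin n) :
    complExp σ l = if l ∈ σ then 0 else 1 := rfl

theorem isSqfree_complExp (σ : Finset (Fin n)) : IsSqfree (complExp σ) := by
  intro l
  rw [complExp_apply]
  split_ifs <;> simp

theorem complExp_injective : Function.Injective (complExp (n := n)) := by
  intro σ τ h
  ext l
  have := DFunLike.congr_fun h l
  simp only [complExp_apply] at this
  by_cases h1 : l ∈ σ <;> by_cases h2 : l ∈ τ <;> simp_all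

theorem IsSqfree.exists_complExp {m : Fin n →₀ ℕ} (h : IsSqfree m) : ∃ σ, complExp σ = m := by
  refine ⟨Finset.univ.filter (m · = 0), ?_⟩
  ext l
  have := h l
  rw [complExp_apply]
  by_cases h0 : m l = 0
  · simp [h0]
  · simp [h0]; omega

theorem mdeg_complExp (σ : Finset (Fin n)) : mdeg (complExp σ) + σ.card = n := by
  have : mdeg (complExp σ) = σᶜ.card := by
    rw [mdeg, Finsupp.sum_fintype _ _ (by simp)]
    simp [complExp_apply, Finset.sum_ite, Finset.filter_not, Finset.compl_eq_univ_sdiff]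
  rw [this, Finset.card_compl_add_card, Fintype.card_fin]

theorem complExp_eq_add_single {σ : Finset (Fin n)} {j : Fin n} (hj : j ∉ σ) :
    complExp σ = complExp (insert j σ) + Finsupp.single j 1 := by
  ext l
  simp only [Finsupp.add_apply, complExp_apply, Finset.mem_insert, Finsupp.single_apply]
  by_cases h : j = l
  · subst h; simp [hj]
  · simp [h, Ne.symm h]

theorem notMem_of_complExp_eq_add_single {σ : Finset (Fin n)} {j : Fin n} {m : Fin n →₀ ℕ}
    (h : complExp σ = m + Finsupp.single j 1) : j ∉ σ := by
  intro hj
  have := DFunLike.congr_fun h j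
  simp [complExp_apply, hj] at this

theorem kSign_complExp (m : Fin n →₀ ℕ) (σ : Finset (Fin n)) :
    kSign K m (complExp σ) =
      ∑ j, if j ∉ σ ∧ complExp (insert j σ) = m then koszulSign K j σ else 0 := by
  unfold kSign
  split_ifs with h
  · have hc := h.choose_spec
    set k := h.choose
    have hk := notMem_of_complExp_eq_add_single hc
    have hm : complExp (insert k σ) = m := by
      rw [complExp_eq_add_single hk] at hc
      exact add_right_cancel hc
    rw [Finset.sum_eq_single k]
    · rw [if_pos ⟨hk, hm⟩, koszulSign]
      congr 2
      ext l
      rw [← hm]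
      simp only [complExp_apply, Finset.mem_filter, Finset.mem_univ, true_and,
        Finset.mem_insert]
      constructor
      · rintro ⟨h1, h2⟩
        refine ⟨?_, h2⟩
        by_contra h3
        simp [h2.ne, h3] at h1
      · rintro ⟨h1, h2⟩
        simp [h1, h2]
    · intro j _ hjk
      rw [if_neg]
      rintro ⟨hj, hjm⟩
      rw [← hjm] at hm
      have : k ∈ insert j σ := complExp_injective hm ▸ Finset.mem_insert_self k σ
      simp [hk, hjk.symm] at this
    · simp
  · refine (Finset.sum_eq_zero fun j _ => ?_).symm
    rw [if_neg]
    rintro ⟨hj, rfl⟩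
    exact h ⟨j, complExp_eq_add_single hj⟩

theorem koszulSign_eq_C (j : Fin n) (σ : Finset (Fin n)) :
    koszulSign (MvPolynomial (Fin n) K) j σ = C (koszulSign K j σ) := by
  simp [koszulSign]

end Monomials

theorem Matrix.exists_mulVec_eq_zero_of_rank_add_rank_lt {K : Type*} [Field K] {c r s : ℕ}
    (A : Matrix (Fin r) (Fin c) K) (B : Matrix (Fin s) (Fin r) K) (h : A.rank + B.rank < r) :
    ∃ y, B.mulVec y = 0 ∧ ∀ v, A.mulVec v ≠ y := by
  by_contra! hcon
  have hle : LinearMap.ker B.mulVecLin ≤ LinearMap.range A.mulVecLin := by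
    intro y hy
    obtain ⟨v, hv⟩ := hcon y (by simpa using hy)
    exact ⟨v, by simpa using hv⟩
  have h1 := Submodule.finrank_mono hle
  have h2 := B.mulVecLin.finrank_range_add_finrank_ker
  rw [Module.finrank_fin_fun] at h2
  unfold Matrix.rank at h
  omega

theorem depth_le_of_rank {K : Type*} [Field K] {n d i c r s : ℕ}
    (I J : Ideal (MvPolynomial (Fin n) K)) (hJI : J < I)
    (hI : GenSqfreeGe K d I) (hJ : GenSqfreeGe K (d + 1) J)
    (hd : 1 ≤ d) (hi : i < n - d)
    (g : Fin c → (Fin n →₀ ℕ)) (f : Fin r → (Fin n →₀ ℕ)) (b : Fin s → (Fin n →₀ ℕ))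
    (hg : Function.Injective g ∧ Set.range g =
      {m : Fin n →₀ ℕ | IsSqfree m ∧ mdeg m = d + i - 1 ∧
        monomial m (1 : K) ∈ I ∧ monomial m (1 : K) ∉ J})
    (hf : Function.Injective f ∧ Set.range f =
      {m : Fin n →₀ ℕ | IsSqfree m ∧ mdeg m = d + i ∧
        monomial m (1 : K) ∈ I ∧ monomial m (1 : K) ∉ J})
    (hb : Function.Injective b ∧ Set.range b =
      {m : Fin n →₀ ℕ | IsSqfree m ∧ mdeg m = d + i + 1 ∧
        monomial m (1 : K) ∈ I ∧ monomial m (1 : K) ∉ J})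
    (hrank : (Matrix.of fun (q : Fin r) (p : Fin c) => kSign K (g p) (f q)).rank + (Matrix.of fun (k : Fin s) (q : Fin r) => kSign K (f q) (b k)).rank < r) :
    mdepth K n (quotMod I J) ≤ d + i := by
  obtain ⟨y, hy, hyA⟩ := Matrix.exists_mulVec_eq_zero_of_rank_add_rank_lt _ _ hrank
  refine csSup_le' ?_
  rintro k ⟨rs, rfl, hrs, hreg⟩
  by_contra! hlen
  have hfm : ∀ q, IsSqfree (f q) ∧ mdeg (f q) = d + i ∧
      monomial (f q) (1 : K) ∈ I ∧ monomial (f q) (1 : K) ∉ J := fun q =>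
    hf.2.le ⟨q, rfl⟩
  have hgm : ∀ p, IsSqfree (g p) ∧ mdeg (g p) = d + i - 1 ∧
      monomial (g p) (1 : K) ∈ I ∧ monomial (g p) (1 : K) ∉ J := fun p =>
    hg.2.le ⟨p, rfl⟩
  let π : I →ₗ[MvPolynomial (Fin n) K] quotMod I J := Submodule.mkQ _
  have hπ : ∀ p : I, π p = 0 ↔ (p : MvPolynomial (Fin n) K) ∈ J := fun p => by
    rw [Submodule.mkQ_apply, Submodule.Quotient.mk_eq_zero]; rfl
  let x : Fin n → MvPolynomial (Fin n) K := X
  let z : Finset (Fin n) → I := fun σ => ∑ q, if complExp σ = f q then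
    ⟨monomial (f q) (y q), monomial_mem_of_monomial_one_mem (hfm q).2.2.1 _⟩ else 0
  have hz : ∀ σ, (z σ : MvPolynomial (Fin n) K) =
      monomial (complExp σ) (∑ q, if complExp σ = f q then y q else 0) := by
    intro σ
    simp only [z, AddSubmonoidClass.coe_finsetSum, map_sum]
    refine Finset.sum_congr rfl fun q _ => ?_
    split_ifs with h
    · simp [h]
    · simp
  have hdz : ∀ τ, ((koszulD x z τ : I) : MvPolynomial (Fin n) K) =
      monomial (complExp τ) (∑ q, kSign K (f q) (complExp τ) * y q) := by
    intro τ
    simp only [koszulD_apply, AddSubmonoidClass.coe_finsetSum, kSign_complExp, Finset.sum_mul]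
    rw [Finset.sum_comm, map_sum]
    refine Finset.sum_congr rfl fun j _ => ?_
    by_cases hj : j ∈ τ
    · simp [hj]
    · rw [if_neg hj, Submodule.coe_smul, hz, koszulSign_eq_C, smul_eq_mul, mul_assoc,
        show x j = X j from rfl, X,
        monomial_mul, C_mul_monomial, complExp_eq_add_single hj, add_comm, one_mul,
        Finset.mul_sum]
      simp [hj]
  have hcycle : koszulD x (fun σ => π (z σ)) = 0 := by
    rw [koszulD_comp]
    ext τ
    rw [Pi.zero_apply, hπ, hdz]
    by_cases hτJ : monomial (complExp τ) (1 : K) ∈ J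
    · exact monomial_mem_of_monomial_one_mem hτJ _
    convert J.zero_mem
    rw [monomial_eq_zero]
    by_cases hτ : ∃ k, b k = complExp τ
    · obtain ⟨k, hk⟩ := hτ
      rw [← hk]
      exact congrFun hy k
    · refine Finset.sum_eq_zero fun q _ => ?_
      rw [kSign, dif_neg, zero_mul]
      rintro ⟨j, hj⟩
      refine hτ (hb.2.ge ⟨isSqfree_complExp τ, ?_, ?_, hτJ⟩)
      · have hjτ := notMem_of_complExp_eq_add_single hj
        have h1 := mdeg_complExp τ
        have h2 := mdeg_complExp (insert j τ)
        rw [Finset.card_insert_of_notMem hjτ] at h2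
        rw [complExp_eq_add_single hjτ] at hj
        rw [add_right_cancel hj, (hfm q).2.1] at h2
        omega
      · rw [hj]
        exact monomial_add_single_mem (hfm q).2.2.1 j
  obtain ⟨u, hu⟩ := exists_koszulD_eq_of_isWeaklyRegular x rs hrs hreg.1 _ hcycle
    (m := n - (d + i)) (fun σ hσ => by
      rw [show z σ = 0 from Finset.sum_eq_zero fun q _ => ?_, map_zero]
      rw [if_neg]
      intro h
      have h1 := mdeg_complExp σ
      rw [h, (hfm q).2.1] at h1
      omega) (by rw [Fintype.card_fin]; omega)
  choose w hw using fun σ => Submodule.mkQ_surjective _ (u σ)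
  obtain rfl : (fun σ => π (w σ)) = u := funext hw
  rw [koszulD_comp] at hu
  choose ρ hρ using fun p => (hgm p).1.exists_complExp
  refine hyA (fun p => coeff (g p) (w (ρ p) : MvPolynomial (Fin n) K)) (funext fun q => ?_)
  obtain ⟨σ, hσ⟩ := (hfm q).1.exists_complExp
  have hmem : ((koszulD x w σ - z σ : I) : MvPolynomial (Fin n) K) ∈ J := by
    rw [← hπ, map_sub, sub_eq_zero]
    exact congrFun hu σ
  have hcoeff : coeff (f q) ((koszulD x w σ : I) : MvPolynomial (Fin n) K) = y q := by
    by_contra hne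
    refine (hfm q).2.2.2 (hJ.monomial_mem hmem ?_)
    rw [Submodule.coe_sub, coeff_sub, sub_ne_zero, hz, hσ, coeff_monomial, if_pos rfl]
    simpa [hf.1.eq_iff] using hne
  rw [← hcoeff]
  simp only [Matrix.mulVec, dotProduct, Matrix.of_apply]
  simp only [← hσ, kSign_complExp, Finset.sum_mul, koszulD_apply,
    AddSubmonoidClass.coe_finsetSum, coeff_sum]
  rw [Finset.sum_comm]
  refine Finset.sum_congr rfl fun j _ => ?_
  by_cases hj : j ∈ σ
  · simp [hj]
  have hright : coeff (complExp σ) (koszulSign (MvPolynomial (Fin n) K) j σ * X j *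
      (w (insert j σ) : MvPolynomial (Fin n) K)) =
      koszulSign K j σ * coeff (complExp (insert j σ)) (w (insert j σ)).1 := by
    rw [koszulSign_eq_C, mul_assoc, coeff_C_mul, complExp_eq_add_single hj, mul_comm (X j),
      coeff_mul_X]
  rw [if_neg hj, Submodule.coe_smul, smul_eq_mul, show x j = X j from rfl, hright]
  by_cases hp : ∃ p, g p = complExp (insert j σ)
  · obtain ⟨p, hp⟩ := hp
    rw [Finset.sum_eq_single p]
    · rw [if_pos ⟨hj, hp.symm⟩, hp, complExp_injective ((hρ p).trans hp)]
    · intro p' _ hne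
      rw [if_neg, zero_mul]
      rintro ⟨-, h⟩
      exact hne (hg.1 (h.symm.trans hp.symm))
    · simp
  · rw [Finset.sum_eq_zero fun p _ => by
      rw [if_neg fun h => hp ⟨p, h.2.symm⟩, zero_mul]]
    by_contra hne
    have hI' := hI.monomial_mem (w (insert j σ)).2 (right_ne_zero_of_mul (Ne.symm hne))
    refine hp (hg.2.ge ⟨isSqfree_complExp _, ?_, hI', fun hJ' => (hfm q).2.2.2 ?_⟩)
    · have h1 := mdeg_complExp σ
      have h2 := mdeg_complExp (insert j σ)
      rw [Finset.card_insert_of_notMem hj] at h2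
      rw [hσ, (hfm q).2.1] at h1
      omega
    · rw [← hσ, complExp_eq_add_single hj]
      exact monomial_add_single_mem hJ' j
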